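/- For every k ≥ 0, one has ζ_{2k} = −Σ_{i=1}^{k} σ_{2i} · ζ_{2k−2i} + σ_{2k+1}, where σ_m is the m-th elementary symmetric polynomial in x_1,…,x_n (with σ_m = 0 for m > n). -/

import Mathlib

open MvPolynomial Matrix

noncomputable section

/-- The matrix `T` over `ℂ[x₁,…,xₙ]` with `T i j = x j` for `i < j`, `-x j` for `i > j`,
and `0` on the diagonal. -/
def Tmat (n : ℕ) : Matrix (Fin n) (Fin n) (MvPolynomial (Fin n) ℂ) :=
  Matrix.of fun i j => if i < j then X j else if j < i then -X j else 0

/-- The polynomial `ζ_m = vᵗ · C · T^m · v`, where `v` is the all-ones vector and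
`C = diag (x₁,…,xₙ)`. -/
def zeta (n m : ℕ) : MvPolynomial (Fin n) ℂ :=
  dotProduct (fun _ => 1)
    ((Matrix.diagonal fun i : Fin n => (X i : MvPolynomial (Fin n) ℂ)).mulVec
      ((Tmat n ^ m).mulVec (fun _ => 1)))

section SignedProducts

variable {ι A : Type*} [Fintype ι] [LinearOrder ι] [CommRing A]

/-- The product of `1 - y j` over `j < i` and of `1 + y j` over `j > i`. -/
def signedProd (y : ι → A) (i : ι) : A :=
  (∏ j with j < i, (1 - y j)) * ∏ j with i < j, (1 + y j)

theorem sum_two_mul_signedProd (y : ι → A) :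
    ∑ i, 2 * y i * signedProd y i = ∏ i, (1 + y i) - ∏ i, (1 - y i) := by
  have h := Finset.prod_sub_ordered (Finset.univ : Finset ι) (fun i => 1 + y i) (fun i => 2 * y i)
  have e : ∀ i, 1 + y i - 2 * y i = 1 - y i := fun i => by ring
  simp only [e] at h
  rw [h, sub_sub_cancel]
  exact Finset.sum_congr rfl fun i _ => by rw [signedProd, ← mul_assoc (2 * y i)]

theorem sum_lt_signedProd (y : ι → A) (i : ι) :
    ∑ j, (if j < i then 2 * y j else 0) * signedProd y j =
      ∏ j, (1 + y j) - (1 + y i) * signedProd y i := by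
  have h := Finset.prod_sub_ordered (Finset.univ : Finset ι) (fun j => 1 + y j)
    (fun j => if j < i then 2 * y j else 0)
  have hw : ∏ j, (1 + y j - if j < i then 2 * y j else 0) = (1 + y i) * signedProd y i := by
    rw [signedProd, Finset.prod_filter, Finset.prod_filter, ← Finset.prod_mul_distrib,
      ← Fintype.prod_ite_eq' i fun j => 1 + y j, ← Finset.prod_mul_distrib]
    refine Finset.prod_congr rfl fun j _ => ?_
    rcases lt_trichotomy j i with hj | rfl | hj
    · simp only [hj, hj.ne, hj.not_gt, if_true, if_false]; ring
    · simp
    · simp [hj, hj.ne', hj.not_gt]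
  rw [← hw, h, sub_sub_cancel]
  refine Finset.sum_congr rfl fun j _ => ?_
  by_cases hj : j < i
  · rw [signedProd, ← mul_assoc]
    congr 2
    refine Finset.prod_congr rfl fun l hl => ?_
    rw [if_pos ((Finset.mem_filter.1 hl).2.trans hj)]
    ring
  · simp [hj]

theorem sum_gt_signedProd (y : ι → A) (i : ι) :
    ∑ j, (if i < j then 2 * y j else 0) * signedProd y j =
      (1 - y i) * signedProd y i - ∏ j, (1 - y j) := by
  have h := sum_two_mul_signedProd y
  have hlt := sum_lt_signedProd y i
  have hsplit : ∑ j, 2 * y j * signedProd y j =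
      ∑ j, (if j < i then 2 * y j else 0) * signedProd y j +
      ∑ j, (if i < j then 2 * y j else 0) * signedProd y j + 2 * y i * signedProd y i := by
    rw [← Fintype.sum_ite_eq' i fun j => 2 * y j * signedProd y j, ← Finset.sum_add_distrib,
      ← Finset.sum_add_distrib]
    refine Finset.sum_congr rfl fun j _ => ?_
    rcases lt_trichotomy j i with hj | rfl | hj
    · simp [hj, hj.ne, hj.not_gt]
    · simp
    · simp [hj, hj.ne', hj.not_gt]
  linear_combination h - hlt - hsplit

theorem two_mul_signedProd (y : ι → A) (i : ι) :
    2 * signedProd y i =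
      2 * ∑ j, (if i < j then y j else if j < i then -y j else 0) * signedProd y j +
        (∏ j, (1 + y j) + ∏ j, (1 - y j)) := by
  have hlt := sum_lt_signedProd y i
  have hgt := sum_gt_signedProd y i
  have hsplit : 2 * ∑ j, (if i < j then y j else if j < i then -y j else 0) * signedProd y j =
      ∑ j, (if i < j then 2 * y j else 0) * signedProd y j -
      ∑ j, (if j < i then 2 * y j else 0) * signedProd y j := by
    rw [Finset.mul_sum, ← Finset.sum_sub_distrib]
    refine Finset.sum_congr rfl fun j _ => ?_
    rcases lt_trichotomy j i with hj | rfl | hj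
    · simp only [hj, hj.not_gt, if_true, if_false]; ring
    · simp
    · simp only [hj, hj.not_gt, if_true, if_false]; ring
  linear_combination hlt - hgt - hsplit

end SignedProducts

theorem coeff_prod_one_add_X_mul_C {ι R : Type*} [Fintype ι] [CommRing R] (x : ι → R) (m : ℕ) :
    (∏ i, (1 + Polynomial.X * Polynomial.C (x i))).coeff m =
      ∑ s ∈ Finset.powersetCard m Finset.univ, ∏ i ∈ s, x i := by
  classical
  rw [Finset.prod_one_add, Polynomial.finsetSum_coeff, Finset.powersetCard_eq_filter,
    Finset.sum_filter]
  refine Finset.sum_congr rfl fun s _ => ?_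
  rw [Finset.prod_mul_distrib, Finset.prod_const, ← map_prod, Polynomial.coeff_mul_C,
    Polynomial.coeff_X_pow]
  simp [eq_comm]

theorem coeff_prod_one_add_X_mul_C_X (n m : ℕ) :
    (∏ i : Fin n, (1 + Polynomial.X * Polynomial.C (X i : MvPolynomial (Fin n) ℂ))).coeff m =
      esymm (Fin n) ℂ m :=
  coeff_prod_one_add_X_mul_C _ m

theorem coeff_prod_one_sub_X_mul_C_X (n m : ℕ) :
    (∏ i : Fin n, (1 - Polynomial.X * Polynomial.C (X i : MvPolynomial (Fin n) ℂ))).coeff m =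
      (-1) ^ m * esymm (Fin n) ℂ m := by
  have h := coeff_prod_one_add_X_mul_C (fun i : Fin n => -(X i : MvPolynomial (Fin n) ℂ)) m
  simp only [map_neg, mul_neg, ← sub_eq_add_neg] at h
  rw [h, esymm, Finset.mul_sum]
  refine Finset.sum_congr rfl fun s hs => ?_
  rw [Finset.prod_neg, (Finset.mem_powersetCard.1 hs).2]

/-- The vector of coefficients of `t ^ m` in the signed products of the `t * x j`. -/
def signedCoeff (n m : ℕ) (i : Fin n) : MvPolynomial (Fin n) ℂ :=
  (signedProd (fun j : Fin n => Polynomial.X * Polynomial.C (X j : MvPolynomial (Fin n) ℂ))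
    i).coeff m

theorem sum_X_mul_signedCoeff (n k : ℕ) :
    ∑ i, X i * signedCoeff n (2 * k) i = esymm (Fin n) ℂ (2 * k + 1) := by
  have h := congrArg (fun p => Polynomial.coeff p (2 * k + 1)) (sum_two_mul_signedProd
    (fun j : Fin n => Polynomial.X * Polynomial.C (X j : MvPolynomial (Fin n) ℂ)))
  simp only [Polynomial.coeff_sub, coeff_prod_one_add_X_mul_C_X, coeff_prod_one_sub_X_mul_C_X,
    mul_assoc, ← Finset.mul_sum, Polynomial.coeff_ofNat_mul, Polynomial.finsetSum_coeff,
    Polynomial.coeff_X_mul, Polynomial.coeff_C_mul] at h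
  refine mul_left_cancel₀ (two_ne_zero (α := MvPolynomial (Fin n) ℂ)) (h.trans ?_)
  rw [Odd.neg_one_pow ⟨k, rfl⟩]
  ring

theorem two_mul_signedCoeff (n m : ℕ) (i : Fin n) :
    2 * signedCoeff n m i =
      2 * (∑ j, Polynomial.X * (Polynomial.C (Tmat n i j) * signedProd
        (fun j : Fin n => Polynomial.X * Polynomial.C (X j : MvPolynomial (Fin n) ℂ)) j)).coeff m +
        (1 + (-1) ^ m) * esymm (Fin n) ℂ m := by
  have hT : ∀ j, (if i < j then Polynomial.X * Polynomial.C (X j : MvPolynomial (Fin n) ℂ)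
      else if j < i then -(Polynomial.X * Polynomial.C (X j)) else 0) =
      Polynomial.X * Polynomial.C (Tmat n i j) := fun j => by
    simp only [Tmat, Matrix.of_apply]
    split_ifs
    · rfl
    · rw [map_neg]
      exact (mul_neg (Polynomial.X : Polynomial (MvPolynomial (Fin n) ℂ)) _).symm
    · rw [map_zero, mul_zero]
  have h := congrArg (fun p => Polynomial.coeff p m) (two_mul_signedProd
    (fun j : Fin n => Polynomial.X * Polynomial.C (X j : MvPolynomial (Fin n) ℂ)) i)
  simp only [hT, mul_assoc, Polynomial.coeff_add, coeff_prod_one_add_X_mul_C_X,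
    coeff_prod_one_sub_X_mul_C_X, Polynomial.coeff_ofNat_mul] at h
  rw [signedCoeff, h, add_mul, one_mul]

theorem signedCoeff_zero (n : ℕ) : signedCoeff n 0 = fun _ => 1 := by
  funext i
  refine mul_left_cancel₀ (two_ne_zero (α := MvPolynomial (Fin n) ℂ)) ?_
  rw [two_mul_signedCoeff, ← Finset.mul_sum, Polynomial.coeff_X_mul_zero, esymm_zero]
  norm_num

theorem two_mul_signedCoeff_succ (n m : ℕ) (i : Fin n) :
    2 * signedCoeff n (m + 1) i = 2 * (Tmat n).mulVec (signedCoeff n m) i +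
      (1 + (-1) ^ (m + 1)) * esymm (Fin n) ℂ (m + 1) := by
  rw [two_mul_signedCoeff, ← Finset.mul_sum, Polynomial.coeff_X_mul,
    Polynomial.finsetSum_coeff]
  simp only [Polynomial.coeff_C_mul]
  rfl

theorem signedCoeff_odd (n k : ℕ) :
    signedCoeff n (2 * k + 1) = (Tmat n).mulVec (signedCoeff n (2 * k)) := by
  funext i
  refine mul_left_cancel₀ (two_ne_zero (α := MvPolynomial (Fin n) ℂ)) ?_
  rw [two_mul_signedCoeff_succ, Odd.neg_one_pow ⟨k, rfl⟩]
  ring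

theorem signedCoeff_even_succ (n k : ℕ) :
    signedCoeff n (2 * (k + 1)) = (Tmat n ^ 2).mulVec (signedCoeff n (2 * k)) +
      esymm (Fin n) ℂ (2 * (k + 1)) • fun _ => 1 := by
  funext i
  refine mul_left_cancel₀ (two_ne_zero (α := MvPolynomial (Fin n) ℂ)) ?_
  have h := two_mul_signedCoeff_succ n (2 * k + 1) i
  rw [signedCoeff_odd, Matrix.mulVec_mulVec, ← sq, Even.neg_one_pow ⟨k + 1, by ring⟩] at h
  refine h.trans ?_
  simp only [Pi.add_apply, Pi.smul_apply, smul_eq_mul, mul_one]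
  ring_nf

theorem signedCoeff_even (n k : ℕ) :
    signedCoeff n (2 * k) = ∑ i ∈ Finset.range (k + 1),
      esymm (Fin n) ℂ (2 * i) • (Tmat n ^ (2 * k - 2 * i)).mulVec (fun _ => 1) := by
  induction k with
  | zero => simp [signedCoeff_zero]
  | succ k ih =>
    rw [signedCoeff_even_succ, ih, Finset.sum_range_succ _ (k + 1), Matrix.mulVec_sum]
    congr 1
    · refine Finset.sum_congr rfl fun i hi => ?_
      have hi' : 2 * (k + 1) - 2 * i = 2 + (2 * k - 2 * i) := by
        have := Finset.mem_range.1 hi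
        omega
      rw [Matrix.mulVec_smul, Matrix.mulVec_mulVec, ← pow_add, hi']
    · simp

theorem zeta_eq_sum (n m : ℕ) :
    zeta n m = ∑ i, X i * (Tmat n ^ m).mulVec (fun _ => 1) i := by
  simp [zeta, dotProduct, Matrix.mulVec_diagonal]

theorem sum_esymm_mul_zeta (n k : ℕ) :
    ∑ i ∈ Finset.range (k + 1), esymm (Fin n) ℂ (2 * i) * zeta n (2 * k - 2 * i) =
      esymm (Fin n) ℂ (2 * k + 1) := by
  rw [← sum_X_mul_signedCoeff, signedCoeff_even]
  simp only [zeta_eq_sum, Finset.sum_apply, Pi.smul_apply, smul_eq_mul, Finset.mul_sum]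
  rw [Finset.sum_comm]
  exact Finset.sum_congr rfl fun i _ => Finset.sum_congr rfl fun j _ => mul_left_comm _ _ _

theorem zeta_expression (n : ℕ) (hn : 0 < n) (k : ℕ) :
    zeta n (2 * k) =
      -(∑ i ∈ Finset.Icc 1 k, esymm (Fin n) ℂ (2 * i) * zeta n (2 * k - 2 * i)) +
        esymm (Fin n) ℂ (2 * k + 1) := by
  rw [← sum_esymm_mul_zeta, Finset.range_eq_Ico, Finset.sum_eq_sum_Ico_succ_bot (Nat.add_one_pos k)]
  simp only [mul_zero, esymm_zero, one_mul, Nat.sub_zero, zero_add]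
  rw [← Finset.Ico_add_one_right_eq_Icc]
  ring
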